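/- Let M be a MAG over a set of variables V, and let A->B and C->D be two invisible directed edges in M with A ≠ C. If there is no bi-directed path between A and C in M, then there is a DAG whose MAG is M in which A and B share a latent parent and, simultaneously, C and D share another latent parent. -/

import Mathlib

open Classical

namespace CG

/-! ### Generic list helpers -/

/-- Consecutive triple on a list. -/
def ListTriple {α : Type} (p : List α) (a b c : α) : Prop :=
  ∃ i : ℕ, p[i]? = some a ∧ p[i+1]? = some b ∧ p[i+2]? = some c

/-- Consecutive pair (an edge) on a list. -/
def ListEdge {α : Type} (p : List α) (a b : α) : Prop :=
  ∃ i : ℕ, p[i]? = some a ∧ p[i+1]? = some b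

/-! ### Mixed graphs (MAGs, PAGs) -/

/-- Edge marks of a mixed graph. -/
inductive Mark : Type
  | tail | arrow | circle
  deriving DecidableEq

/-- A mixed graph over `V`: `mark a b` is the edge mark at `b` on the edge
between `a` and `b` (`none` if there is no edge). -/
structure MixedGraph (V : Type) where
  mark : V → V → Option Mark

namespace MixedGraph

variable {V : Type} (G : MixedGraph V)

def WellFormed : Prop :=
  (∀ a b : V, (G.mark a b).isSome ↔ (G.mark b a).isSome) ∧ ∀ a : V, G.mark a a = none

def Adj (a b : V) : Prop := (G.mark a b).isSome

/-- Directed edge `a → b`. -/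
def DirEdge (a b : V) : Prop := G.mark a b = some Mark.arrow ∧ G.mark b a = some Mark.tail

/-- Bi-directed edge `a ↔ b`. -/
def BiEdge (a b : V) : Prop := G.mark a b = some Mark.arrow ∧ G.mark b a = some Mark.arrow

/-- Edge with circle marks at both ends. -/
def CircleEdge (a b : V) : Prop := G.mark a b = some Mark.circle ∧ G.mark b a = some Mark.circle

def NoCircles : Prop := ∀ a b : V, G.mark a b ≠ some Mark.circle

def StrictAnc : V → V → Prop := Relation.TransGen G.DirEdge

/-- `a` is an ancestor of `b` (reflexive). -/
def Anc : V → V → Prop := Relation.ReflTransGen G.DirEdge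

/-- No directed cycles and no almost-directed cycles. -/
def Ancestral : Prop :=
  (∀ a : V, ¬ G.StrictAnc a a) ∧ ∀ a b : V, G.BiEdge a b → ¬ G.StrictAnc a b

def IsPath (p : List V) : Prop := 2 ≤ p.length ∧ p.Nodup ∧ p.Chain' G.Adj

def IsPathBetween (X Y : V) (p : List V) : Prop :=
  G.IsPath p ∧ p.head? = some X ∧ p.getLast? = some Y

/-- `b` is a collider between `a` and `c` (arrowheads at `b` on both edges). -/
def Collider (a b c : V) : Prop := G.mark a b = some Mark.arrow ∧ G.mark c b = some Mark.arrow

/-- Every non-endpoint node of `p` is a collider on `p`. -/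
def AllColliders (p : List V) : Prop := ∀ a b c : V, ListTriple p a b c → G.Collider a b c

/-- `b` is a definite non-collider between `a` and `c`. -/
def DefNonCollider (a b c : V) : Prop :=
  (G.mark a b = some Mark.tail ∨ G.mark c b = some Mark.tail) ∨
  (G.mark a b = some Mark.circle ∧ G.mark c b = some Mark.circle ∧ ¬ G.Adj a c)

/-- Every non-endpoint node of `p` is a definite collider or definite non-collider. -/
def DefStatusPath (p : List V) : Prop :=
  ∀ a b c : V, ListTriple p a b c → G.Collider a b c ∨ G.DefNonCollider a b c

/-- The path `p` is into its first node (arrowhead at the first node). -/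
def IntoFirst (p : List V) : Prop :=
  ∃ a b : V, p[0]? = some a ∧ p[1]? = some b ∧ G.mark b a = some Mark.arrow

/-- The path `p` is into its last node. -/
def IntoLast (p : List V) : Prop := G.IntoFirst p.reverse

/-- m-connecting path between `X` and `Y` given `Z`. -/
def MConnPath (Z : Set V) (X Y : V) (p : List V) : Prop :=
  G.IsPathBetween X Y p ∧
  ∀ a b c : V, ListTriple p a b c →
    (G.Collider a b c → ∃ z ∈ Z, G.Anc b z) ∧ (¬ G.Collider a b c → b ∉ Z)

/-- m-separation. -/
def MSep (X Y : V) (Z : Set V) : Prop := ¬ ∃ p : List V, G.MConnPath Z X Y p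

/-- Every pair of non-adjacent nodes is m-separated by some set. -/
def Maximal : Prop :=
  ∀ a b : V, a ≠ b → ¬ G.Adj a b → ∃ Z : Set V, a ∉ Z ∧ b ∉ Z ∧ G.MSep a b Z

def IsMAG : Prop := G.WellFormed ∧ G.NoCircles ∧ G.Ancestral ∧ G.Maximal

/-- Markov equivalence: same m-separation relations. -/
def MarkovEq (G₁ G₂ : MixedGraph V) : Prop :=
  ∀ (X Y : V) (Z : Set V), G₁.MSep X Y Z ↔ G₂.MSep X Y Z

/-- Possibly directed edge step from `a` to `b`: an edge not into `a`. -/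
def PossDirStep (a b : V) : Prop := G.Adj a b ∧ G.mark b a ≠ some Mark.arrow

/-- `a` is a possible ancestor of `b`. -/
def PossAnc : V → V → Prop := Relation.ReflTransGen G.PossDirStep

/-- Connected by a circle path (same bucket). -/
def SameBucket : V → V → Prop := Relation.ReflTransGen G.CircleEdge

/-- Bi-directed path in a mixed graph. -/
def BiPath (p : List V) : Prop := 2 ≤ p.length ∧ p.Nodup ∧ p.Chain' G.BiEdge

/-- Induced subgraph over `A` (all nodes kept; edges outside `A` removed). -/
noncomputable def restrict (A : Set V) : MixedGraph V :=
  ⟨fun a b => if a ∈ A ∧ b ∈ A then G.mark a b else none⟩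

end MixedGraph

/-! ### DAGs with latent variables -/

/-- A directed graph over observed nodes `V` and latent nodes `L`. -/
structure LatDAG (V L : Type) where
  edge : V ⊕ L → V ⊕ L → Prop

namespace LatDAG

variable {V L : Type} (D : LatDAG V L)

/-- Acyclic, every latent node is parentless and has exactly two children, both observed. -/
def IsCausalDAG : Prop :=
  (∀ x : V ⊕ L, ¬ Relation.TransGen D.edge x x) ∧
  (∀ (x : V ⊕ L) (l : L), ¬ D.edge x (Sum.inr l)) ∧
  (∀ l : L, ∃ a b : V, a ≠ b ∧ D.edge (Sum.inr l) (Sum.inl a) ∧ D.edge (Sum.inr l) (Sum.inl b) ∧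
    ∀ c : V ⊕ L, D.edge (Sum.inr l) c → c = Sum.inl a ∨ c = Sum.inl b)

def Adj (x y : V ⊕ L) : Prop := D.edge x y ∨ D.edge y x

/-- Ancestor (reflexive). -/
def Anc : V ⊕ L → V ⊕ L → Prop := Relation.ReflTransGen D.edge

def IsPath (p : List (V ⊕ L)) : Prop := 2 ≤ p.length ∧ p.Nodup ∧ p.Chain' D.Adj

def IsPathBetween (x y : V ⊕ L) (p : List (V ⊕ L)) : Prop :=
  D.IsPath p ∧ p.head? = some x ∧ p.getLast? = some y

/-- The path `p` is into its first node (arrowhead at the first node). -/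
def IntoFirst (p : List (V ⊕ L)) : Prop :=
  ∃ a b : V ⊕ L, p[0]? = some a ∧ p[1]? = some b ∧ D.edge b a

def IntoLast (p : List (V ⊕ L)) : Prop := D.IntoFirst p.reverse

/-- Inducing path between observed `X` and `Y` (relative to the latent nodes):
every non-endpoint observed node is a collider on the path and an ancestor of `X` or `Y`. -/
def InducingPath (X Y : V) (p : List (V ⊕ L)) : Prop :=
  D.IsPathBetween (Sum.inl X) (Sum.inl Y) p ∧
  ∀ a b c : V ⊕ L, ListTriple p a b c → ∀ v : V, b = Sum.inl v →
    (D.edge a b ∧ D.edge c b) ∧ (D.Anc b (Sum.inl X) ∨ D.Anc b (Sum.inl Y))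

/-- `a` and `b` are joined by a bi-directed edge, i.e. share a latent parent. -/
def LatentSib (a b : V) : Prop :=
  a ≠ b ∧ ∃ l : L, D.edge (Sum.inr l) (Sum.inl a) ∧ D.edge (Sum.inr l) (Sum.inl b)

/-- Bi-directed path between observed nodes (listing the observed nodes). -/
def BiPath (p : List V) : Prop := 2 ≤ p.length ∧ p.Nodup ∧ p.Chain' D.LatentSib

/-- Same c-component (reflexive): connected by a bi-directed path. -/
def CConn : V → V → Prop := Relation.ReflTransGen D.LatentSib

/-- Induced subgraph over `A ⊆ V`: keep observed nodes of `A` and the latent nodes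
both of whose children are in `A`. -/
def restrict (A : Set V) : LatDAG V L :=
  ⟨fun x y =>
    D.edge x y ∧
    (∀ v : V, x = Sum.inl v → v ∈ A) ∧ (∀ v : V, y = Sum.inl v → v ∈ A) ∧
    (∀ l : L, x = Sum.inr l → ∀ w : V, D.edge (Sum.inr l) (Sum.inl w) → w ∈ A) ∧
    (∀ l : L, y = Sum.inr l → ∀ w : V, D.edge (Sum.inr l) (Sum.inl w) → w ∈ A)⟩

/-- `F` is a c-forest with root set `R` in `D`. -/
def CForest (F R : Set V) : Prop :=
  R ⊆ F ∧
  (∀ a ∈ F, ∀ b ∈ F, ∀ c ∈ F,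
    D.edge (Sum.inl a) (Sum.inl b) → D.edge (Sum.inl a) (Sum.inl c) → b = c) ∧
  R = {a ∈ F | ∀ b ∈ F, ¬ D.edge (Sum.inl a) (Sum.inl b)} ∧
  (∀ a ∈ F, ∀ b ∈ F, Relation.ReflTransGen (fun u w => u ∈ F ∧ w ∈ F ∧ D.LatentSib u w) a b)

end LatDAG

/-- `M` is the MAG of the DAG `D` over the observed nodes. -/
def IsMAGof {V L : Type} (M : MixedGraph V) (D : LatDAG V L) : Prop :=
  (∀ X Y : V, M.Adj X Y ↔ ∃ p : List (V ⊕ L), D.InducingPath X Y p) ∧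
  ∀ X Y : V, M.Adj X Y →
    (M.DirEdge X Y ↔ D.Anc (Sum.inl X) (Sum.inl Y)) ∧
    (M.BiEdge X Y ↔ ¬ D.Anc (Sum.inl X) (Sum.inl Y) ∧ ¬ D.Anc (Sum.inl Y) (Sum.inl X))

/-- The directed edge `A → B` of the MAG `M` is visible: no DAG whose MAG is `M`
has an inducing path between `A` and `B` that is into `A`. -/
def MagVisible {V : Type} (M : MixedGraph V) (A B : V) : Prop :=
  M.DirEdge A B ∧
  ∀ (L : Type) (D : LatDAG V L), D.IsCausalDAG → IsMAGof M D →
    ¬ ∃ p : List (V ⊕ L), D.InducingPath A B p ∧ D.IntoFirst p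

/-- `P` is the PAG of the MAG `M`: same adjacencies, and an arrowhead/tail mark appears
in `P` iff it appears in every Markov equivalent MAG. -/
def IsPAGof {V : Type} (P M : MixedGraph V) : Prop :=
  (∀ a b : V, P.Adj a b ↔ M.Adj a b) ∧
  ∀ a b : V, P.Adj a b →
    ((P.mark a b = some Mark.arrow ↔
        ∀ M' : MixedGraph V, M'.IsMAG → MixedGraph.MarkovEq M M' →
          M'.mark a b = some Mark.arrow) ∧
     (P.mark a b = some Mark.tail ↔
        ∀ M' : MixedGraph V, M'.IsMAG → MixedGraph.MarkovEq M M' →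
          M'.mark a b = some Mark.tail))

/-- The directed edge `A → B` of a PAG `P` is visible: `A → B` in `P` and the edge is
visible in every MAG of the equivalence class represented by `P`. -/
def PagVisible {V : Type} (P : MixedGraph V) (A B : V) : Prop :=
  P.DirEdge A B ∧ ∀ M : MixedGraph V, M.IsMAG → IsPAGof P M → MagVisible M A B

/-- `X` and `Y` are in the same pc-component of the MAG `M`. -/
def SamePCCompMag {V : Type} (M : MixedGraph V) (X Y : V) : Prop :=
  X = Y ∨ ∃ p : List V, M.IsPathBetween X Y p ∧ M.AllColliders p ∧
    ∀ a b : V, ListEdge p a b → ¬ MagVisible M a b ∧ ¬ MagVisible M b a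

/-- `X` and `Y` are in the same pc-component of the PAG `P`. -/
def SamePCCompPag {V : Type} (P : MixedGraph V) (X Y : V) : Prop :=
  X = Y ∨ ∃ p : List V, P.IsPathBetween X Y p ∧ P.AllColliders p ∧
    ∀ a b : V, ListEdge p a b → ¬ PagVisible P a b ∧ ¬ PagVisible P b a

/-- `D` is a DAG in the Markov equivalence class represented by the PAG `P`. -/
def DagInClass {V L : Type} (P : MixedGraph V) (D : LatDAG V L) : Prop :=
  ∃ M : MixedGraph V, M.IsMAG ∧ IsMAGof M D ∧ IsPAGof P M

/-- `C` is a possible child of `X` in a PAG: they are adjacent, the mark at `X` is not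
an arrowhead and the mark at `C` is not a tail. -/
def PossChild {V : Type} (P : MixedGraph V) (X C : V) : Prop :=
  P.Adj X C ∧ P.mark C X ≠ some Mark.arrow ∧ P.mark X C ≠ some Mark.tail

/-- The dc-component of the set `X` in a mixed graph. -/
def DCComp {V : Type} (G : MixedGraph V) (X : Set V) : Set V :=
  {a | ∃ x ∈ X, Relation.ReflTransGen G.BiEdge x a}

/-- The identification criterion of the theorem: no node `Xi ∈ X` is in the same
pc-component of `P_T` with a possible child `C ∈ T \ X`. -/
def BucketCrit {V : Type} (P : MixedGraph V) (T X : Set V) : Prop :=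
  ¬ ∃ Xi ∈ X, ∃ C, C ∈ T ∧ C ∉ X ∧
    PossChild (P.restrict T) Xi C ∧ SamePCCompPag (P.restrict T) Xi C

/-- `B 1 < ... < B m` is a partial topological order over the buckets of `G` covering `T`. -/
def IsBucketTopEnum {V : Type} (G : MixedGraph V) (T : Set V)
    {m : ℕ} (B : Fin m → Set V) : Prop :=
  (∀ i, (B i).Nonempty) ∧ (∀ i, B i ⊆ T) ∧ (⋃ i, B i) = T ∧
  (∀ i j, i ≠ j → Disjoint (B i) (B j)) ∧
  (∀ i, ∀ a ∈ B i, B i = {b | G.SameBucket a b}) ∧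
  (∀ i j, i ≠ j → ∀ a ∈ B i, ∀ b ∈ B j, G.mark a b = some Mark.arrow → i < j)

/-- `B` is a bucket of `G` (with representative in `T`). -/
def IsBucketOf {V : Type} (G : MixedGraph V) (T B : Set V) : Prop :=
  ∃ a ∈ T, B = {b | G.SameBucket a b}

/-! ### Discrete causal models and c-factors -/

/-- A discrete causal model of a DAG `D`, with observed variables valued in `Ω`. -/
structure CModel {V L : Type} [DecidableEq V] [DecidableEq L]
    (D : LatDAG V L) (Ω : Type) [Fintype Ω] where
  latS : L → Type
  latFin : ∀ l : L, Fintype (latS l)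
  latNE : ∀ l : L, Nonempty (latS l)
  cpt : V ⊕ L → (V → Ω) × (∀ l : L, latS l) → ℝ
  cpt_nonneg : ∀ x c, 0 ≤ cpt x c
  cpt_local : ∀ (x : V ⊕ L) (c c' : (V → Ω) × (∀ l : L, latS l)),
    (∀ v : V, (x = Sum.inl v ∨ D.edge (Sum.inl v) x) → c.1 v = c'.1 v) →
    (∀ l : L, (x = Sum.inr l ∨ D.edge (Sum.inr l) x) → c.2 l = c'.2 l) →
    cpt x c = cpt x c'
  cpt_norm_obs : ∀ (v : V) (c : (V → Ω) × (∀ l : L, latS l)),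
    ∑ ω : Ω, cpt (Sum.inl v) (Function.update c.1 v ω, c.2) = 1
  cpt_norm_lat : ∀ (l : L) (c : (V → Ω) × (∀ l : L, latS l)),
    ((@Finset.univ (latS l) (latFin l)).sum
      fun s => cpt (Sum.inr l) (c.1, Function.update c.2 l s)) = 1

/-- The c-factor `Q[T]`, as a function of a full assignment to the observed variables
(the values outside `T` play the role of the intervention values). -/
noncomputable def CModel.Q {V L : Type} [Fintype V] [DecidableEq V] [Fintype L]
    [DecidableEq L] {D : LatDAG V L} {Ω : Type} [Fintype Ω]
    (M : CModel D Ω) (T : Set V) (c : V → Ω) : ℝ :=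
  letI : ∀ l : L, Fintype (M.latS l) := M.latFin
  ∑ g : ∀ l : L, M.latS l,
    (∏ v : V, if v ∈ T then M.cpt (Sum.inl v) (c, g) else 1) *
      ∏ l : L, M.cpt (Sum.inr l) (c, g)

/-- `Q[T \ X]` is identifiable from `Q[T]` in the PAG `P`: a single functional maps
`Q[T]` to `Q[T \ X]` uniformly over every DAG in the class represented by `P`. -/
def QIdentifiable {V : Type} [Fintype V] [DecidableEq V]
    (P : MixedGraph V) (T X : Set V) : Prop :=
  ∀ (Ω : Type) [Fintype Ω] [Nonempty Ω],
    ∃ F : ((V → Ω) → ℝ) → ((V → Ω) → ℝ),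
      ∀ (L : Type) [Fintype L] [DecidableEq L] (D : LatDAG V L),
        D.IsCausalDAG → DagInClass P D →
        ∀ M : CModel D Ω, F (M.Q T) = M.Q (T \ X)

/-- `Q[T \ X]` is identifiable from `Q[T]` in the DAG `D`. -/
def DagIdentifiable {V L : Type} [Fintype V] [DecidableEq V] [Fintype L] [DecidableEq L]
    (D : LatDAG V L) (T X : Set V) : Prop :=
  ∀ (Ω : Type) [Fintype Ω] [Nonempty Ω],
    ∃ F : ((V → Ω) → ℝ) → ((V → Ω) → ℝ),
      ∀ M : CModel D Ω, F (M.Q T) = M.Q (T \ X)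

/-- Probability, under the distribution `q` over the variables of `T` (context fixed
outside `T`), that the variables of `W` take the values given by `c`. -/
noncomputable def MarginProb {V Ω : Type} [Fintype V] [Fintype Ω]
    (T : Set V) (q : (V → Ω) → ℝ) (W : Set V) (c : V → Ω) : ℝ :=
  ∑ d : V → Ω, if (∀ v : V, (v ∈ W ∨ v ∉ T) → d v = c v) then q d else 0

/-- Conditional term `P_{v\t}(Bi | Prev)` computed from `q = Q[T]`. -/
noncomputable def CondTerm {V Ω : Type} [Fintype V] [Fintype Ω]
    (T : Set V) (q : (V → Ω) → ℝ) (Bi Prev : Set V) (c : V → Ω) : ℝ :=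
  MarginProb T q (Bi ∪ Prev) c / MarginProb T q Prev c

/-- Product of the conditional terms of the buckets contained in the dc-component of `X`. -/
noncomputable def BucketDenom {V Ω : Type} [Fintype V] [Fintype Ω]
    (P : MixedGraph V) (T X : Set V) {m : ℕ} (B : Fin m → Set V)
    (q : (V → Ω) → ℝ) (c : V → Ω) : ℝ :=
  ∏ i ∈ Finset.univ.filter (fun i : Fin m => B i ⊆ DCComp (P.restrict T) X),
    CondTerm T q (B i) {v | ∃ j : Fin m, j < i ∧ v ∈ B j} c

/-- The identification formula: `Q[T\X] = (Q[T] / ∏ P(B_i | B^{(i-1)})) · Σ_x ∏ P(B_i |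
B^{(i-1)})`, the product over the buckets of `P_T` inside the dc-component of `X` in a
partial topological order, summed over the values of `X` in the numerator. -/
def BucketFormula {V : Type} [Fintype V] [DecidableEq V]
    (P : MixedGraph V) (T X : Set V) : Prop :=
  ∀ (m : ℕ) (B : Fin m → Set V), IsBucketTopEnum (P.restrict T) T B →
    ∀ (Ω : Type) [Fintype Ω] [Nonempty Ω] (L : Type) [Fintype L] [DecidableEq L]
      (D : LatDAG V L), D.IsCausalDAG → DagInClass P D →
      ∀ (M : CModel D Ω) (c : V → Ω),
        M.Q (T \ X) c =
          M.Q T c / BucketDenom P T X B (M.Q T) c *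
            ∑ d : V → Ω,
              if (∀ v : V, v ∉ X → d v = c v) then BucketDenom P T X B (M.Q T) d else 0

/-- A hedge for `Q[W]` (`W = T \ X`) formed by the intervention set `X`. -/
def IsHedge {V L : Type} (D : LatDAG V L) (W X : Set V) (F F' : Set V) : Prop :=
  ∃ R : Set V, R ⊆ W ∧ F' ⊆ F ∧ F ⊆ W ∪ X ∧ (F ∩ X).Nonempty ∧ F' ∩ X = ∅ ∧
    D.CForest F R ∧ D.CForest F' R

/-! ### Adjustment, GAC and the IDP algorithm -/

/-- Proper possibly directed path from the set `X` to the set `Y` in a PAG. -/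
def ProperPDPath {V : Type} (P : MixedGraph V) (X Y : Set V) (p : List V) : Prop :=
  P.IsPath p ∧ (∃ x ∈ X, p.head? = some x) ∧ (∃ y ∈ Y, p.getLast? = some y) ∧
  (∀ v ∈ p.tail, v ∉ X) ∧ ∀ a b : V, ListEdge p a b → P.mark b a ≠ some Mark.arrow

/-- `P` is amenable relative to `(X, Y)`: every proper possibly directed path from `X`
to `Y` starts with a visible directed edge out of `X`. -/
def Amenable {V : Type} (P : MixedGraph V) (X Y : Set V) : Prop :=
  ∀ p : List V, ProperPDPath P X Y p →
    ∃ a b : V, p[0]? = some a ∧ p[1]? = some b ∧ PagVisible P a b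

/-- The forbidden set: possible descendants of nodes `w ∉ X` lying on proper possibly
directed paths from `X` to `Y`. -/
def Forb {V : Type} (P : MixedGraph V) (X Y : Set V) : Set V :=
  {d | ∃ (w : V) (p : List V), ProperPDPath P X Y p ∧ w ∈ p ∧ w ∉ X ∧ P.PossAnc w d}

/-- Proper definite status non-causal path from `X` to `Y`. -/
def ProperDefNonCausal {V : Type} (P : MixedGraph V) (X Y : Set V) (p : List V) : Prop :=
  P.IsPath p ∧ P.DefStatusPath p ∧ (∃ x ∈ X, p.head? = some x) ∧
  (∃ y ∈ Y, p.getLast? = some y) ∧ (∀ v ∈ p.tail, v ∉ X) ∧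
  ∃ a b : V, ListEdge p a b ∧ P.mark b a = some Mark.arrow

/-- `Z` blocks the definite status path `p`. -/
def BlocksPath {V : Type} (P : MixedGraph V) (Z : Set V) (p : List V) : Prop :=
  (∃ a b c : V, ListTriple p a b c ∧ P.DefNonCollider a b c ∧ b ∈ Z) ∨
  (∃ a b c : V, ListTriple p a b c ∧ P.Collider a b c ∧ ∀ z ∈ Z, ¬ P.PossAnc b z)

/-- `Z` satisfies the generalized adjustment criterion relative to `(X, Y)` in `P`. -/
def SatGAC {V : Type} (P : MixedGraph V) (X Y Z : Set V) : Prop :=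
  Amenable P X Y ∧ Z ∩ Forb P X Y = ∅ ∧
  ∀ p : List V, ProperDefNonCausal P X Y p → BlocksPath P Z p

/-- The canonical adjustment set `Adjust(X, Y, P)`. -/
def AdjustSet {V : Type} (P : MixedGraph V) (X Y : Set V) : Set V :=
  {v | ∃ w ∈ X ∪ Y, P.PossAnc v w} \ (Forb P X Y ∪ X ∪ Y)

/-- The subroutine `Identify(C, T, Q[T])` of IDP succeeds: it repeatedly removes a
bucket of `P_T` disjoint from `C` satisfying the interventional criterion, until `T = C`. -/
inductive IdentifySucc {V : Type} (P : MixedGraph V) (C : Set V) : Set V → Prop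
  | base : IdentifySucc P C C
  | step (T B : Set V) (hBT : B ⊆ T) (hBC : Disjoint B C) (hne : B.Nonempty)
      (hbucket : IsBucketOf (P.restrict T) T B) (hcrit : BucketCrit P T B)
      (h : IdentifySucc P C (T \ B)) : IdentifySucc P C T

/-- The IDP algorithm succeeds on `P_x(y)`: with `D` the set of possible ancestors of `Y`
in `P_{V \ X}`, every cpc-component of `P_D` is identified by `Identify` from `Q[V]`. -/
def IDPSucc {V : Type} (P : MixedGraph V) (X Y : Set V) : Prop :=
  ∀ a ∈ {d : V | ∃ y ∈ Y, (P.restrict Xᶜ).PossAnc d y},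
    IdentifySucc P
      {b : V | b ∈ {d : V | ∃ y ∈ Y, (P.restrict Xᶜ).PossAnc d y} ∧
        Relation.ReflTransGen
          (fun u w =>
            SamePCCompPag (P.restrict {d : V | ∃ y ∈ Y, (P.restrict Xᶜ).PossAnc d y}) u w ∨
            (P.restrict {d : V | ∃ y ∈ Y, (P.restrict Xᶜ).PossAnc d y}).SameBucket u w)
          a b}
      Set.univ

/-- Definite m-connecting path in a PAG given `Z`. -/
def DefMConnPath {V : Type} (P : MixedGraph V) (Z : Set V) (X Y : V) (p : List V) : Prop :=
  P.IsPathBetween X Y p ∧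
  ∀ a b c : V, ListTriple p a b c →
    (P.Collider a b c → ∃ z ∈ Z, P.PossAnc b z) ∧
    (¬ P.Collider a b c → P.DefNonCollider a b c ∧ b ∉ Z)


/-! ### Collider connections

An inducing path between `X` and `Y` amounts to a connection between them in the symmetric
relation `LinkStep`, whose nodes are ancestors of `X` or `Y` and whose steps are bi-directed
edges, or directed edges leaving `X` or `Y`. -/

/-- A step between two nodes of `S`: a `bi`-edge, or a `dir`-edge whose tail lies in `P`. -/
def LinkStep {V : Type} (dir bi : V → V → Prop) (S P : V → Prop) (u v : V) : Prop :=
  S u ∧ S v ∧ (bi u v ∨ (P u ∧ dir u v) ∨ (P v ∧ dir v u))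

lemma LinkStep.symm {V : Type} {dir bi : V → V → Prop} {S P : V → Prop}
    (hbi : ∀ a b, bi a b → bi b a) {u v : V} (h : LinkStep dir bi S P u v) :
    LinkStep dir bi S P v u := by
  obtain ⟨hu, hv, h⟩ := h
  exact ⟨hv, hu, h.elim (fun h => Or.inl (hbi _ _ h)) fun h => Or.inr h.symm⟩

lemma reflTransGen_symm {α : Type} {r : α → α → Prop} (hr : ∀ a b, r a b → r b a) {x y : α}
    (h : Relation.ReflTransGen r x y) : Relation.ReflTransGen r y x := by
  induction h with
  | refl => exact .refl
  | tail _ hbc ih => exact .head (hr _ _ hbc) ih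

/-- Nodes connected by a symmetric relation are joined by a list without repetitions. -/
lemma exists_nodup_chain {α : Type} {r : α → α → Prop} (hr : ∀ a b, r a b → r b a) {x y : α}
    (h : Relation.ReflTransGen r x y) (hne : x ≠ y) :
    ∃ p : List α, 2 ≤ p.length ∧ p.Nodup ∧ p.IsChain r ∧
      p.head? = some x ∧ p.getLast? = some y := by
  let G : SimpleGraph α :=
    { Adj := fun a b => a ≠ b ∧ r a b
      symm := ⟨fun a b h => ⟨h.1.symm, hr _ _ h.2⟩⟩
      loopless := ⟨fun a h => h.1 rfl⟩ }
  have hreach : G.Reachable x y := by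
    induction h with
    | refl => exact absurd rfl hne
    | @tail b c hab hbc ih =>
      by_cases hbc' : b = c
      · subst hbc'; exact ih hne
      · have hadj : G.Adj b c := ⟨hbc', hbc⟩
        by_cases hxb : x = b
        · subst hxb; exact hadj.reachable
        · exact (ih hxb).trans hadj.reachable
  obtain ⟨w, hw⟩ := hreach.exists_isPath
  refine ⟨w.support, ?_, hw.support_nodup, w.isChain_adj_support.imp fun _ _ h => h.2, ?_, ?_⟩
  · have : w.length ≠ 0 := fun h0 => hne (SimpleGraph.Walk.eq_of_length_eq_zero h0)
    rw [SimpleGraph.Walk.length_support]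
    omega
  · rw [List.head?_eq_some_head w.support_ne_nil, w.head_support]
  · rw [List.getLast?_eq_some_getLast w.support_ne_nil, w.getLast_support]

namespace LatDAG

variable {V L : Type} {D : LatDAG V L}

/-- Directed edge between observed nodes. -/
def ObsEdge (D : LatDAG V L) (a b : V) : Prop := D.edge (Sum.inl a) (Sum.inl b)

/-- `v` is an ancestor of `X` or of `Y`. -/
def AncEither (D : LatDAG V L) (X Y v : V) : Prop :=
  D.Anc (Sum.inl v) (Sum.inl X) ∨ D.Anc (Sum.inl v) (Sum.inl Y)

lemma LatentSib.symm {a b : V} (h : D.LatentSib a b) : D.LatentSib b a := by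
  obtain ⟨hne, l, ha, hb⟩ := h
  exact ⟨hne.symm, l, hb, ha⟩

lemma IsCausalDAG.not_edge_symm (hD : D.IsCausalDAG) {x y : V ⊕ L} (h : D.edge x y) :
    ¬ D.edge y x :=
  fun h' => hD.1 x (.tail (.single h) h')

lemma anc_inl_iff (hlat : ∀ x l, ¬ D.edge x (Sum.inr l)) (x y : V) :
    D.Anc (Sum.inl x) (Sum.inl y) ↔ Relation.ReflTransGen D.ObsEdge x y := by
  constructor
  · suffices H : ∀ z : V ⊕ L, D.Anc (Sum.inl x) z →
        ∃ w, z = Sum.inl w ∧ Relation.ReflTransGen D.ObsEdge x w by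
      intro h
      obtain ⟨w, hw, h'⟩ := H _ h
      exact Sum.inl.inj hw ▸ h'
    intro z hz
    induction hz with
    | refl => exact ⟨x, rfl, .refl⟩
    | @tail b c _ hbc ih =>
      obtain ⟨w, rfl, h'⟩ := ih
      cases c with
      | inl c => exact ⟨c, rfl, .tail h' hbc⟩
      | inr l => exact absurd hbc (hlat _ _)
  · intro h
    induction h with
    | refl => exact .refl
    | tail _ hbc ih => exact .tail ih hbc

lemma InducingPath.ne {X Y : V} {p : List (V ⊕ L)} (hp : D.InducingPath X Y p) : X ≠ Y := by
  obtain ⟨⟨hlen, hnd, -⟩, hhead, hlast⟩ := hp.1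
  rintro rfl
  rw [List.head?_eq_getElem?] at hhead
  rw [List.getLast?_eq_getElem?] at hlast
  obtain ⟨h0, h0'⟩ := List.getElem?_eq_some_iff.1 hhead
  obtain ⟨h1, h1'⟩ := List.getElem?_eq_some_iff.1 hlast
  have := (hnd.getElem_inj_iff (hi := h0) (hj := h1)).1 (h0'.trans h1'.symm)
  omega

/-- The observed nodes of an inducing path are connected by collider steps; only the endpoints
may be left along a directed edge, and not the first one when the path is into it. -/
lemma InducingPath.reflTransGen (hD : D.IsCausalDAG) {X Y : V} {p : List (V ⊕ L)}
    (hp : D.InducingPath X Y p) {P : V → Prop} (hY : P Y) (hX : P X ∨ D.IntoFirst p) :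
    Relation.ReflTransGen (LinkStep D.ObsEdge D.LatentSib (D.AncEither X Y) P) X Y := by
  obtain ⟨⟨⟨hlen, hnd, hch⟩, hhead, hlast⟩, hcol⟩ := hp
  have hch' : p.IsChain D.Adj := hch
  rw [List.isChain_iff_getElem] at hch'
  have h0 : p[0] = Sum.inl X := by
    rw [List.head?_eq_getElem?, List.getElem?_eq_getElem (by omega)] at hhead
    exact Option.some.inj hhead
  have hl : p[p.length - 1] = Sum.inl Y := by
    rw [List.getLast?_eq_getElem?, List.getElem?_eq_getElem (by omega)] at hlast
    exact Option.some.inj hlast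
  have hin : ∀ i, (hi : i + 2 < p.length) → ∀ v, p[i + 1] = Sum.inl v →
      (D.edge p[i] p[i + 1] ∧ D.edge p[i + 2] p[i + 1]) ∧ D.AncEither X Y v := by
    intro i hi v hv
    have := hcol p[i] p[i + 1] p[i + 2] ⟨i, by simp, by simp, by simp⟩ v hv
    rw [AncEither, ← hv]
    exact this
  have hS : ∀ i, (hi : i < p.length) → ∀ v, p[i] = Sum.inl v → D.AncEither X Y v := by
    intro i hi v hv
    rcases Nat.eq_zero_or_pos i with rfl | hpos
    · rw [h0] at hv
      cases hv
      exact Or.inl .refl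
    · obtain ⟨j, rfl⟩ : ∃ j, i = j + 1 := ⟨i - 1, by omega⟩
      by_cases hj : j + 2 < p.length
      · exact (hin j hj v hv).2
      · have : p[j + 1] = p[p.length - 1] := by congr 1; omega
        rw [this, hl] at hv
        cases hv
        exact Or.inr .refl
  have key : ∀ i, (hi : i < p.length) →
      (∀ v, p[i] = Sum.inl v →
        Relation.ReflTransGen (LinkStep D.ObsEdge D.LatentSib (D.AncEither X Y) P) X v) ∧
      (∀ l, p[i] = Sum.inr l → ∃ v, D.edge (Sum.inr l) (Sum.inl v) ∧ D.AncEither X Y v ∧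
        Relation.ReflTransGen (LinkStep D.ObsEdge D.LatentSib (D.AncEither X Y) P) X v) := by
    intro i
    induction i with
    | zero =>
      intro hi
      rw [h0]
      refine ⟨?_, ?_⟩
      · rintro v ⟨⟩
        exact .refl
      · rintro l ⟨⟩
    | succ i ih =>
      intro hi
      obtain ⟨ih1, ih2⟩ := ih (by omega)
      have hadj := hch' i hi
      refine ⟨fun w hw => ?_, fun l hl' => ?_⟩
      · have hSw := hS _ hi w hw
        rcases hpi : p[i] with v | l
        · have hSv := hS _ (by omega) v hpi
          refine .tail (ih1 v hpi) ⟨hSv, hSw, Or.inr ?_⟩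
          have hback : D.edge p[i + 1] p[i] → P w ∧ D.ObsEdge w v := by
            intro he
            by_cases hend : i + 2 < p.length
            · exact absurd he (hD.not_edge_symm (hin i hend w hw).1.1)
            · have : p[i + 1] = p[p.length - 1] := by congr 1; omega
              rw [this, hl] at hw
              cases hw
              rw [this, hl, hpi] at he
              exact ⟨hY, he⟩
          rcases Nat.eq_zero_or_pos i with rfl | hpos
          · rw [h0] at hpi
            cases hpi
            rcases hX with hX | ⟨a, b, ha, hb, hab⟩
            · rcases hadj with he | he
              · rw [h0, hw] at he
                exact Or.inl ⟨hX, he⟩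
              · exact Or.inr (hback he)
            · refine Or.inr (hback ?_)
              rw [List.getElem?_eq_getElem (by omega)] at ha hb
              cases ha
              cases hb
              exact hab
          · obtain ⟨j, rfl⟩ : ∃ j, i = j + 1 := ⟨i - 1, by omega⟩
            exact Or.inr (hback (hin j (by omega) v hpi).1.2)
        · obtain ⟨v, hlv, hSv, hv⟩ := ih2 l hpi
          have hlw : D.edge (Sum.inr l) (Sum.inl w) := by
            rw [hpi, hw] at hadj
            exact hadj.resolve_right (hD.2.1 _ _)
          by_cases hvw : v = w
          · exact hvw ▸ hv
          · exact .tail hv ⟨hSv, hSw, Or.inl ⟨hvw, l, hlv, hlw⟩⟩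
      · have he : D.edge (Sum.inr l) p[i] := by
          rw [hl'] at hadj
          exact hadj.resolve_left (hD.2.1 _ _)
        rcases hpi : p[i] with v | l'
        · rw [hpi] at he
          exact ⟨v, he, hS _ (by omega) v hpi, ih1 v hpi⟩
        · rw [hpi] at he
          exact absurd he (hD.2.1 _ _)
  exact (key (p.length - 1) (by omega)).1 Y hl

/-- Collider connections are realized by inducing paths. -/
lemma exists_inducingPath (hD : D.IsCausalDAG) {X Y : V} (hne : X ≠ Y)
    (h : Relation.ReflTransGen
      (LinkStep D.ObsEdge D.LatentSib (D.AncEither X Y) (fun v => v = X ∨ v = Y)) X Y) :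
    ∃ p, D.InducingPath X Y p := by
  let T : V ⊕ L → V ⊕ L → Prop := fun a b => D.Adj a b ∧
    (∀ v, a = Sum.inl v → D.AncEither X Y v) ∧ (∀ v, b = Sum.inl v → D.AncEither X Y v) ∧
    (∀ v, a = Sum.inl v → D.edge a b → v = X ∨ v = Y) ∧
    (∀ v, b = Sum.inl v → D.edge b a → v = X ∨ v = Y)
  have hT : ∀ a b, T a b → T b a := fun a b ⟨h1, h2, h3, h4, h5⟩ => ⟨h1.symm, h3, h2, h5, h4⟩
  have hdir : ∀ u v, D.AncEither X Y u → D.AncEither X Y v → (u = X ∨ u = Y) →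
      D.ObsEdge u v → T (Sum.inl u) (Sum.inl v) := by
    intro u v hu hv hP he
    refine ⟨Or.inl he, ?_, ?_, ?_, ?_⟩
    · rintro _ ⟨⟩; exact hu
    · rintro _ ⟨⟩; exact hv
    · rintro _ ⟨⟩ _; exact hP
    · intro _ _ he'; exact absurd he' (hD.not_edge_symm he)
  have hlat : ∀ l u, D.AncEither X Y u → D.edge (Sum.inr l) (Sum.inl u) →
      T (Sum.inr l) (Sum.inl u) := by
    intro l u hu he
    refine ⟨Or.inl he, ?_, ?_, ?_, ?_⟩
    · rintro _ ⟨⟩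
    · rintro _ ⟨⟩; exact hu
    · rintro _ ⟨⟩
    · intro _ _ he'; exact absurd he' (hD.2.1 _ _)
  have hreach : Relation.ReflTransGen T (Sum.inl X) (Sum.inl Y) := by
    suffices H : ∀ w, Relation.ReflTransGen (LinkStep D.ObsEdge D.LatentSib (D.AncEither X Y)
        (fun v => v = X ∨ v = Y)) X w → Relation.ReflTransGen T (Sum.inl X) (Sum.inl w) from H Y h
    intro w hw
    induction hw with
    | refl => exact .refl
    | @tail u v _ huv ih =>
      obtain ⟨hu, hv, ⟨-, l, hlu, hlv⟩ | ⟨hP, he⟩ | ⟨hP, he⟩⟩ := huv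
      · exact .tail (.tail ih (hT _ _ (hlat l u hu hlu))) (hlat l v hv hlv)
      · exact .tail ih (hdir u v hu hv hP he)
      · exact .tail ih (hT _ _ (hdir v u hv hu hP he))
  obtain ⟨p, hlen, hnd, hch, hhead, hlast⟩ :=
    exists_nodup_chain hT hreach (fun h => hne (Sum.inl.inj h))
  refine ⟨p, ⟨⟨hlen, hnd, hch.imp fun _ _ h => h.1⟩, hhead, hlast⟩, ?_⟩
  rintro a b c ⟨i, ha, hb, hc⟩ v rfl
  obtain ⟨hi0, ha⟩ := List.getElem?_eq_some_iff.1 ha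
  obtain ⟨hi1, hb⟩ := List.getElem?_eq_some_iff.1 hb
  obtain ⟨hi2, hc⟩ := List.getElem?_eq_some_iff.1 hc
  rw [List.isChain_iff_getElem] at hch
  have hab := hch i hi1
  have hbc := hch (i + 1) hi2
  rw [ha, hb] at hab
  rw [hb, hc] at hbc
  have hnP : ¬ (v = X ∨ v = Y) := by
    rintro (rfl | rfl)
    · rw [List.head?_eq_getElem?] at hhead
      obtain ⟨h0, h0'⟩ := List.getElem?_eq_some_iff.1 hhead
      have := (hnd.getElem_inj_iff (hi := h0) (hj := hi1)).1 (h0'.trans hb.symm)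
      omega
    · rw [List.getLast?_eq_getElem?] at hlast
      obtain ⟨h0, h0'⟩ := List.getElem?_eq_some_iff.1 hlast
      have := (hnd.getElem_inj_iff (hi := h0) (hj := hi1)).1 (h0'.trans hb.symm)
      omega
  exact ⟨⟨hab.1.resolve_right fun he => hnP (hab.2.2.2.2 v rfl he),
    hbc.1.resolve_left fun he => hnP (hbc.2.2.2.1 v rfl he)⟩, hab.2.2.1 v rfl⟩

/-- Restricting endpoints: connections for `u, v` are connections for `X, Y` whenever `u` and `v`
are ancestors of these and no new directed exit is used. -/
lemma link_mono {u v X Y : V} {P P' : V → Prop} (hu : D.AncEither X Y u) (hv : D.AncEither X Y v)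
    (hP : ∀ a b, P' a → D.ObsEdge a b → D.AncEither u v b → P a) {x y : V}
    (h : Relation.ReflTransGen (LinkStep D.ObsEdge D.LatentSib (D.AncEither u v) P') x y) :
    Relation.ReflTransGen (LinkStep D.ObsEdge D.LatentSib (D.AncEither X Y) P) x y := by
  have hS : ∀ a, D.AncEither u v a → D.AncEither X Y a := by
    rintro a (ha | ha)
    · exact hu.imp ha.trans ha.trans
    · exact hv.imp ha.trans ha.trans
  refine Relation.ReflTransGen.mono ?_ _ _ h
  rintro a b ⟨ha, hb, hab⟩
  refine ⟨hS a ha, hS b hb, hab.imp id fun hab => ?_⟩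
  exact hab.imp (fun h => ⟨hP a b h.1 h.2 hb, h.2⟩) fun h => ⟨hP b a h.1 h.2 ha, h.2⟩

lemma not_ancEither_of_obsEdge (hD : D.IsCausalDAG) {u v b : V}
    (huv : D.Anc (Sum.inl u) (Sum.inl v)) (hvb : D.ObsEdge v b) : ¬ D.AncEither u v b := by
  rintro (h | h)
  · exact hD.1 _ (Relation.TransGen.head' hvb (h.trans huv))
  · exact hD.1 _ (Relation.TransGen.head' hvb h)

lemma inducingPath_of_edge {a b : V} (hne : a ≠ b) (h : D.Adj (Sum.inl a) (Sum.inl b)) :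
    D.InducingPath a b [Sum.inl a, Sum.inl b] := by
  refine ⟨⟨⟨by simp, by simpa using hne, ?_⟩, rfl, rfl⟩, ?_⟩
  · exact List.isChain_pair.2 h
  · rintro _ _ _ ⟨i, -, -, h⟩
    simp at h

lemma inducingPath_of_latentSib {a b : V} (h : D.LatentSib a b) :
    ∃ p, D.InducingPath a b p := by
  obtain ⟨hne, l, ha, hb⟩ := h
  refine ⟨[Sum.inl a, Sum.inr l, Sum.inl b], ⟨⟨by simp, by simpa using hne, ?_⟩, rfl, rfl⟩, ?_⟩
  · exact List.isChain_cons_cons.2 ⟨Or.inr ha, List.isChain_pair.2 (Or.inl hb)⟩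
  · rintro _ c _ ⟨i, -, hc, h⟩ v rfl
    rcases i with _ | i <;> simp at h hc

end LatDAG

namespace MixedGraph

variable {V : Type} {M : MixedGraph V}

/-- `v` is an ancestor of `X` or of `Y`. -/
def AncEither (M : MixedGraph V) (X Y v : V) : Prop := M.Anc v X ∨ M.Anc v Y

/-- `a` and `b` are `A` and `B` in some order. -/
def IsPair (A B a b : V) : Prop := (a = A ∧ b = B) ∨ (a = B ∧ b = A)

/-- Steps of a collider path between `X` and `Y` in `M`, where `T` holds additional bi-directed
edges. -/
def ColliderStep (M : MixedGraph V) (T : V → V → Prop) (X Y : V) : V → V → Prop :=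
  LinkStep M.DirEdge (fun a b => M.BiEdge a b ∨ T a b) (M.AncEither X Y)
    (fun v => v = X ∨ v = Y)

/-- Adding the bi-directed edge `A ↔ B` creates no inducing path between non-adjacent nodes. -/
def Confoundable (M : MixedGraph V) (A B : V) : Prop :=
  ∀ X Y, X ≠ Y → Relation.ReflTransGen (M.ColliderStep (IsPair A B) X Y) X Y → M.Adj X Y

lemma DirEdge.adj {a b : V} (h : M.DirEdge a b) : M.Adj a b := by simp [Adj, h.1]

lemma BiEdge.adj {a b : V} (h : M.BiEdge a b) : M.Adj a b := by simp [Adj, h.1]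

lemma BiEdge.symm {a b : V} (h : M.BiEdge a b) : M.BiEdge b a := ⟨h.2, h.1⟩

lemma ColliderStep.symm {T : V → V → Prop} (hT : ∀ a b, T a b → T b a) {X Y a b : V}
    (h : M.ColliderStep T X Y a b) : M.ColliderStep T X Y b a :=
  LinkStep.symm (fun _ _ h => h.imp BiEdge.symm (hT _ _)) h

end MixedGraph

namespace IsMAGof

variable {V L : Type} {M : MixedGraph V} {D : LatDAG V L}

lemma ne_of_adj (h : IsMAGof M D) {a b : V} (hab : M.Adj a b) : a ≠ b := by
  obtain ⟨p, hp⟩ := (h.1 a b).1 hab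
  exact hp.ne

lemma dirEdge_of_obsEdge (h : IsMAGof M D) (hD : D.IsCausalDAG) {a b : V}
    (hab : D.ObsEdge a b) : M.DirEdge a b := by
  have hne : a ≠ b := fun he => hD.1 _ (.single (he ▸ hab : D.edge (Sum.inl a) (Sum.inl a)))
  exact ((h.2 a b ((h.1 a b).2 ⟨_, LatDAG.inducingPath_of_edge hne (Or.inl hab)⟩)).1).2
    (.single hab)

lemma anc_iff (h : IsMAGof M D) (hD : D.IsCausalDAG) (a b : V) :
    D.Anc (Sum.inl a) (Sum.inl b) ↔ M.Anc a b := by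
  constructor
  · intro hab
    exact Relation.ReflTransGen.mono (fun _ _ => h.dirEdge_of_obsEdge hD) _ _
      ((LatDAG.anc_inl_iff hD.2.1 a b).1 hab)
  · intro hab
    induction hab with
    | refl => exact .refl
    | tail _ hbc ih => exact ih.trans (((h.2 _ _ hbc.adj).1).1 hbc)

lemma edge_trichotomy (h : IsMAGof M D) {a b : V} (hab : M.Adj a b) (hba : M.Adj b a) :
    M.DirEdge a b ∨ M.DirEdge b a ∨ M.BiEdge a b := by
  by_cases h1 : D.Anc (Sum.inl a) (Sum.inl b)
  · exact Or.inl ((h.2 a b hab).1.2 h1)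
  · by_cases h2 : D.Anc (Sum.inl b) (Sum.inl a)
    · exact Or.inr (Or.inl ((h.2 b a hba).1.2 h2))
    · exact Or.inr (Or.inr ((h.2 a b hab).2.2 ⟨h1, h2⟩))

/-- If a DAG with MAG `M` has an inducing path between `A` and `B` into `A`, where `A → B`, then
the bi-directed edge `A ↔ B` may be added to `M`. -/
lemma confoundable (h : IsMAGof M D) (hD : D.IsCausalDAG) {A B : V} (hAB : M.DirEdge A B)
    {p : List (V ⊕ L)} (hp : D.InducingPath A B p) (hinto : D.IntoFirst p) :
    M.Confoundable A B := by
  intro X Y hne hXY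
  refine (h.1 X Y).2 (LatDAG.exists_inducingPath hD hne ?_)
  have hsymm : ∀ {u v : V}, Relation.ReflTransGen (LinkStep D.ObsEdge D.LatentSib
      (D.AncEither X Y) (fun v => v = X ∨ v = Y)) u v → Relation.ReflTransGen
      (LinkStep D.ObsEdge D.LatentSib (D.AncEither X Y) (fun v => v = X ∨ v = Y)) v u :=
    reflTransGen_symm fun _ _ h => h.symm fun _ _ => LatDAG.LatentSib.symm
  have hS : ∀ {u}, M.AncEither X Y u → D.AncEither X Y u :=
    fun hu => hu.imp (h.anc_iff hD _ _).2 (h.anc_iff hD _ _).2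
  have hdir : ∀ {u v}, M.AncEither X Y u → M.AncEither X Y v → (u = X ∨ u = Y) →
      M.DirEdge u v → Relation.ReflTransGen (LinkStep D.ObsEdge D.LatentSib
      (D.AncEither X Y) (fun v => v = X ∨ v = Y)) u v := by
    intro u v hu hv hP huv
    obtain ⟨q, hq⟩ := (h.1 u v).1 huv.adj
    have hanc := (h.2 u v huv.adj).1.1 huv
    refine LatDAG.link_mono (hS hu) (hS hv) ?_
      (hq.reflTransGen hD (P := fun w => w = u ∨ w = v) (Or.inr rfl) (Or.inl (Or.inl rfl)))
    rintro a b (rfl | rfl) hab hb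
    · exact hP
    · exact absurd hb (LatDAG.not_ancEither_of_obsEdge hD hanc hab)
  have hpair : M.AncEither X Y A → M.AncEither X Y B → Relation.ReflTransGen
      (LinkStep D.ObsEdge D.LatentSib (D.AncEither X Y) (fun v => v = X ∨ v = Y)) A B := by
    intro hA hB
    refine LatDAG.link_mono (hS hA) (hS hB) ?_
      (hp.reflTransGen hD (P := fun w => w = B) rfl (Or.inr hinto))
    rintro a b rfl hab hb
    exact absurd hb (LatDAG.not_ancEither_of_obsEdge hD ((h.2 _ _ hAB.adj).1.1 hAB) hab)
  suffices H : ∀ w, Relation.ReflTransGen (M.ColliderStep (MixedGraph.IsPair A B) X Y) X w →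
      Relation.ReflTransGen (LinkStep D.ObsEdge D.LatentSib (D.AncEither X Y)
        (fun v => v = X ∨ v = Y)) X w from H Y hXY
  intro w hw
  induction hw with
  | refl => exact .refl
  | @tail u v _ huv ih =>
    refine ih.trans ?_
    obtain ⟨hu, hv, (hbi | ⟨rfl, rfl⟩ | ⟨rfl, rfl⟩) | ⟨hP, he⟩ | ⟨hP, he⟩⟩ := huv
    · obtain ⟨q, hq⟩ := (h.1 u v).1 hbi.adj
      obtain ⟨h1, h2⟩ := (h.2 u v hbi.adj).2.1 hbi
      refine LatDAG.link_mono (hS hu) (hS hv) ?_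
        (hq.reflTransGen hD (P := fun w => w = u ∨ w = v) (Or.inr rfl) (Or.inl (Or.inl rfl)))
      rintro a b (rfl | rfl) hab (hb | hb)
      · exact absurd (Relation.TransGen.head' (show D.edge _ _ from hab) hb) (hD.1 _)
      · exact absurd (Relation.ReflTransGen.head (show D.edge _ _ from hab) hb) h1
      · exact absurd (Relation.ReflTransGen.head (show D.edge _ _ from hab) hb) h2
      · exact absurd (Relation.TransGen.head' (show D.edge _ _ from hab) hb) (hD.1 _)
    · exact hpair hu hv
    · exact hsymm (hpair hv hu)
    · exact hdir hu hv hP he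
    · exact hsymm (hdir hv hu hP he)

end IsMAGof

namespace MixedGraph

variable {V : Type} {M : MixedGraph V}

/-- A confoundable edge `A → B` extends collider connections from an endpoint to `A` up to `B`,
without using `A ↔ B`. -/
lemma Confoundable.extend {A B : V} (hc : M.Confoundable A B) (hAB : M.DirEdge A B)
    (hM : M.Ancestral)
    (htri : ∀ a b, M.Adj a b → M.DirEdge a b ∨ M.DirEdge b a ∨ M.BiEdge a b)
    {X Y u : V} (hB : M.AncEither X Y B) (hu : u = X ∨ u = Y)
    (h : Relation.ReflTransGen (M.ColliderStep (fun _ _ => False) X Y) u A) :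
    Relation.ReflTransGen (M.ColliderStep (fun _ _ => False) X Y) u B := by
  have hS : ∀ {v}, (v = X ∨ v = Y) → M.AncEither X Y v := by
    rintro v (rfl | rfl)
    · exact Or.inl .refl
    · exact Or.inr .refl
  have hend : ∀ {v}, (v = X ∨ v = Y) → M.DirEdge v B →
      M.ColliderStep (fun _ _ => False) X Y v B :=
    fun hv hvB => ⟨hS hv, hB, Or.inr (Or.inl ⟨hv, hvB⟩)⟩
  have hlast : ∀ {v w}, M.DirEdge w B → Relation.ReflTransGen
      (fun a b => M.BiEdge a b ∧ M.DirEdge a B ∧ M.DirEdge b B) w A →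
      v ≠ B → (M.BiEdge v w ∨ M.DirEdge v w) → M.Adj v B := by
    intro v w hwB hw hne hvw
    refine hc v B hne ?_
    have hpar : ∀ {a}, M.DirEdge a B → M.AncEither v B a := fun ha => Or.inr (.single ha)
    refine .head ⟨Or.inl .refl, hpar hwB, hvw.imp Or.inl fun h => Or.inl ⟨Or.inl rfl, h⟩⟩ ?_
    refine .tail (Relation.ReflTransGen.mono ?_ _ _ hw)
      ⟨hpar hAB, Or.inr .refl, Or.inl (Or.inr (Or.inl ⟨rfl, rfl⟩))⟩
    exact fun a b hab => ⟨hpar hab.2.1, hpar hab.2.2, Or.inl (Or.inl hab.1)⟩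
  have key : Relation.ReflTransGen (M.ColliderStep (fun _ _ => False) X Y) u B ∨
      (M.DirEdge u B ∧ Relation.ReflTransGen
        (fun a b => M.BiEdge a b ∧ M.DirEdge a B ∧ M.DirEdge b B) u A) := by
    clear hu
    induction h using Relation.ReflTransGen.head_induction_on with
    | refl => exact Or.inr ⟨hAB, .refl⟩
    | @head v w hvw _ ih =>
      rcases ih with ih | ⟨hwB, hw⟩
      · exact Or.inl (.head hvw ih)
      have hv := hvw.1
      rcases hvw.2.2 with (hbi | hf) | ⟨hP, he⟩ | ⟨hP, he⟩
      · have hne : v ≠ B := fun hvB => hM.2 w v hbi.symm (.single (hvB ▸ hwB))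
        rcases htri _ _ (hlast hwB hw hne (Or.inl hbi)) with h1 | h1 | h1
        · exact Or.inr ⟨h1, .head ⟨hbi, h1, hwB⟩ hw⟩
        · exact absurd (.tail (.single hwB) h1) (hM.2 w v hbi.symm)
        · exact Or.inl (.single ⟨hv, hB, Or.inl (Or.inl h1)⟩)
      · exact hf.elim
      · have hne : v ≠ B := fun hvB => hM.1 v (.tail (.single he) (hvB ▸ hwB))
        rcases htri _ _ (hlast hwB hw hne (Or.inr he)) with h1 | h1 | h1
        · exact Or.inl (.single (hend hP h1))
        · exact absurd (.tail (.tail (.single he) hwB) h1) (hM.1 v)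
        · exact Or.inl (.single ⟨hv, hB, Or.inl (Or.inl h1)⟩)
      · exact Or.inl (.head hvw (.single (hend hP hwB)))
  exact key.elim id fun h => .single (hend hu h.1)

end MixedGraph

/-- Suppose the steps of `s` preserve `f` except for those between `A, B` and between `C, E`, and
neither of the classes of `A` and `C` is that of `X` or `Y` unless the exceptional steps from it
preserve `f`. If moreover `A` and `C` then lie in different classes, `s`-connected `X` and `Y` lie
in the same class. -/
lemma eq_of_reflTransGen_pairs {V W : Type} {f : V → W} {s : V → V → Prop} {p q : Prop}
    {A B C E X Y : V}
    (hs : ∀ u v, s u v → f u = f v ∨ (p ∧ MixedGraph.IsPair A B u v) ∨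
      (q ∧ MixedGraph.IsPair C E u v))
    (hA : p → f A ≠ f B → f X ≠ f A ∧ f Y ≠ f A) (hC : q → f C ≠ f E → f X ≠ f C ∧ f Y ≠ f C)
    (hAC : f A = f C → f X = f A ∨ f Y = f A) (h : Relation.ReflTransGen s X Y) : f X = f Y := by
  have H : ∀ w, Relation.ReflTransGen s X w →
      f X = f w ∨ (p ∧ f A ≠ f B ∧ f X = f B ∧ f A = f w) ∨
      (q ∧ f C ≠ f E ∧ f X = f E ∧ f C = f w) ∨
      (p ∧ q ∧ f A ≠ f B ∧ f C ≠ f E ∧ f X = f B ∧ f A = f E ∧ f C = f w) ∨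
      (p ∧ q ∧ f A ≠ f B ∧ f C ≠ f E ∧ f X = f E ∧ f C = f B ∧ f A = f w) := by
    intro w hw
    induction hw with
    | refl => exact Or.inl rfl
    | @tail u v hXu huv ih =>
      have huv' := hs u v huv
      clear hs h huv hXu
      rcases huv' with h1 | ⟨h1, ⟨rfl, rfl⟩ | ⟨rfl, rfl⟩⟩ | ⟨h1, ⟨rfl, rfl⟩ | ⟨rfl, rfl⟩⟩
      · rwa [← h1]
      all_goals
        rcases ih with ih | ih | ih | ih | ih <;> grind
  have hY := H Y h
  clear hs H h
  grind

namespace MixedGraph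

variable {V : Type}

/-- Children of the latent nodes of `confoundedDAG`. -/
def latentEnds (M : MixedGraph V) (A B C E : V) :
    {e : V × V // M.BiEdge e.1 e.2} ⊕ Bool → V × V
  | Sum.inl e => e.1
  | Sum.inr true => (A, B)
  | Sum.inr false => (C, E)

/-- The canonical DAG of `M`, with a latent node for every bi-directed edge of `M`, together with
additional latent parents of `A, B` and of `C, E`. -/
def confoundedDAG (M : MixedGraph V) (A B C E : V) :
    LatDAG V ({e : V × V // M.BiEdge e.1 e.2} ⊕ Bool) where
  edge
    | Sum.inl a, Sum.inl b => M.DirEdge a b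
    | Sum.inr l, Sum.inl b => b = (M.latentEnds A B C E l).1 ∨ b = (M.latentEnds A B C E l).2
    | _, Sum.inr _ => False

variable {M : MixedGraph V} {A B C E : V}

lemma isCausalDAG_confoundedDAG (hacyc : ∀ a, ¬ M.StrictAnc a a)
    (hbi : ∀ a b, M.BiEdge a b → a ≠ b) (hAB : A ≠ B) (hCE : C ≠ E) :
    (M.confoundedDAG A B C E).IsCausalDAG := by
  have hlat : ∀ x l, ¬ (M.confoundedDAG A B C E).edge x (Sum.inr l) := by
    rintro (x | x) l h <;> exact h
  refine ⟨?_, hlat, ?_⟩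
  · rintro (v | l) hx
    · obtain ⟨w | l, hvw, hwv⟩ := Relation.TransGen.head'_iff.1 hx
      · exact hacyc v (.head' hvw ((LatDAG.anc_inl_iff hlat w v).1 hwv))
      · exact hlat _ _ hvw
    · obtain ⟨b, -, hb⟩ := Relation.TransGen.tail'_iff.1 hx
      exact hlat _ _ hb
  · intro l
    refine ⟨(M.latentEnds A B C E l).1, (M.latentEnds A B C E l).2, ?_, Or.inl rfl, Or.inr rfl, ?_⟩
    · rcases l with e | _ | _
      · exact hbi _ _ e.2
      · exact hCE
      · exact hAB
    · rintro (c | c) hc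
      · exact hc.imp (congrArg _) (congrArg _)
      · exact hc.elim

lemma latentSib_confoundedDAG {a b : V} (h : (M.confoundedDAG A B C E).LatentSib a b) :
    M.BiEdge a b ∨ IsPair A B a b ∨ IsPair C E a b := by
  obtain ⟨hne, l, ha, hb⟩ := h
  have hab : IsPair (M.latentEnds A B C E l).1 (M.latentEnds A B C E l).2 a b := by
    rcases ha with ha | ha <;> rcases hb with hb | hb
    · exact absurd (ha.trans hb.symm) hne
    · exact Or.inl ⟨ha, hb⟩
    · exact Or.inr ⟨ha, hb⟩
    · exact absurd (ha.trans hb.symm) hne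
  rcases l with e | _ | _
  · rcases hab with ⟨rfl, rfl⟩ | ⟨rfl, rfl⟩
    · exact Or.inl e.2
    · exact Or.inl e.2.symm
  · exact Or.inr (Or.inr hab)
  · exact Or.inr (Or.inl hab)

/-- A collider connection from `A` to `C` that cannot reach `X` or `Y` is bi-directed. -/
lemma reflTransGen_biEdge_of_not_connected {X Y : V}
    (h : Relation.ReflTransGen (M.ColliderStep (fun _ _ => False) X Y) A C)
    (hX : ¬ Relation.ReflTransGen (M.ColliderStep (fun _ _ => False) X Y) A X)
    (hY : ¬ Relation.ReflTransGen (M.ColliderStep (fun _ _ => False) X Y) A Y) :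
    Relation.ReflTransGen M.BiEdge A C := by
  have hend : ∀ {w}, Relation.ReflTransGen (M.ColliderStep (fun _ _ => False) X Y) A w →
      ¬ (w = X ∨ w = Y) := by
    rintro w hw (rfl | rfl)
    · exact hX hw
    · exact hY hw
  induction h with
  | refl => exact .refl
  | @tail v w hv hvw ih =>
    rcases hvw.2.2 with (hbi | hf) | ⟨hP, -⟩ | ⟨hP, -⟩
    · exact .tail ih hbi
    · exact hf.elim
    · exact absurd hP (hend hv)
    · exact absurd hP (hend (.tail hv hvw))

/-- Two confoundable edges whose tails are not joined by a bi-directed path are confoundable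
simultaneously. -/
lemma isMAGof_confoundedDAG (hM : M.Ancestral) (hirr : ∀ a b, M.Adj a b → a ≠ b)
    (htri : ∀ a b, M.Adj a b → M.DirEdge a b ∨ M.DirEdge b a ∨ M.BiEdge a b)
    (hAB : M.DirEdge A B) (hCE : M.DirEdge C E)
    (hcAB : M.Confoundable A B) (hcCE : M.Confoundable C E)
    (hAC : ¬ Relation.ReflTransGen M.BiEdge A C) :
    IsMAGof M (M.confoundedDAG A B C E) := by
  have hD := isCausalDAG_confoundedDAG (E := E) hM.1 (fun a b h => hirr a b h.adj)
    (hirr A B hAB.adj) (hirr C E hCE.adj)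
  have hanc : ∀ a b, (M.confoundedDAG A B C E).Anc (Sum.inl a) (Sum.inl b) ↔ M.Anc a b :=
    LatDAG.anc_inl_iff hD.2.1
  refine ⟨fun X Y => ⟨fun hXY => ?_, ?_⟩, fun X Y hXY => ?_⟩
  · have hne := hirr X Y hXY
    rcases htri X Y hXY with h | h | h
    · exact ⟨_, LatDAG.inducingPath_of_edge hne (Or.inl h)⟩
    · exact ⟨_, LatDAG.inducingPath_of_edge hne (Or.inr h)⟩
    · exact LatDAG.inducingPath_of_latentSib
        ⟨hne, Sum.inl ⟨(X, Y), h⟩, Or.inl rfl, Or.inr rfl⟩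
  · rintro ⟨p, hp⟩
    have hne := hp.ne
    let r : Setoid V :=
      { r := Relation.ReflTransGen (M.ColliderStep (fun _ _ => False) X Y)
        iseqv := ⟨fun _ => .refl, reflTransGen_symm fun _ _ h => h.symm fun _ _ => id,
          Relation.ReflTransGen.trans⟩ }
    have hr : ∀ {a b}, Quotient.mk r a = Quotient.mk r b ↔
      Relation.ReflTransGen (M.ColliderStep (fun _ _ => False) X Y) a b := Quotient.eq
    have hstep := hp.reflTransGen hD (P := fun v => v = X ∨ v = Y) (Or.inr rfl)
      (Or.inl (Or.inl rfl))
    have hS : ∀ {v}, (M.confoundedDAG A B C E).AncEither X Y v → M.AncEither X Y v :=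
      fun h => h.imp (hanc _ _).1 (hanc _ _).1
    have hredundant : ∀ {A B}, M.DirEdge A B → M.Confoundable A B → M.AncEither X Y B →
        Quotient.mk r A ≠ Quotient.mk r B →
        Quotient.mk r X ≠ Quotient.mk r A ∧ Quotient.mk r Y ≠ Quotient.mk r A := by
      intro A B hAB hc hB hne'
      refine ⟨fun h => hne' (h.symm.trans ?_), fun h => hne' (h.symm.trans ?_)⟩
      · exact hr.2 (hc.extend hAB hM htri hB (Or.inl rfl) (hr.1 h))
      · exact hr.2 (hc.extend hAB hM htri hB (Or.inr rfl) (hr.1 h))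
    have hXY : Quotient.mk r X = Quotient.mk r Y := by
      refine eq_of_reflTransGen_pairs (p := M.AncEither X Y B) (q := M.AncEither X Y E) ?_
        (hredundant hAB hcAB) (hredundant hCE hcCE) ?_ hstep
      · rintro u v ⟨hu, hv, h | h⟩
        · rcases latentSib_confoundedDAG h with h | h | h
          · exact Or.inl (hr.2 (.single ⟨hS hu, hS hv, Or.inl (Or.inl h)⟩))
          · refine Or.inr (Or.inl ⟨?_, h⟩)
            rcases h with ⟨rfl, rfl⟩ | ⟨rfl, rfl⟩
            exacts [hS hv, hS hu]
          · refine Or.inr (Or.inr ⟨?_, h⟩)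
            rcases h with ⟨rfl, rfl⟩ | ⟨rfl, rfl⟩
            exacts [hS hv, hS hu]
        · exact Or.inl (hr.2 (.single ⟨hS hu, hS hv, Or.inr h⟩))
      · intro h
        by_contra hcon
        rw [not_or] at hcon
        exact hAC (reflTransGen_biEdge_of_not_connected (hr.1 h)
          (fun h' => hcon.1 (hr.2 h').symm) fun h' => hcon.2 (hr.2 h').symm)
    exact hcAB X Y hne (Relation.ReflTransGen.mono
      (fun a b h => ⟨h.1, h.2.1, h.2.2.imp (fun h => h.imp id False.elim) id⟩) _ _ (hr.1 hXY))
  · rw [hanc, hanc]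
    have hstrict : ∀ {a b}, a ≠ b → M.Anc a b → M.StrictAnc a b := fun hne h =>
      (Relation.reflTransGen_iff_eq_or_transGen.1 h).resolve_left fun h => hne h.symm
    have hne := hirr X Y hXY
    have hbi_not : M.BiEdge X Y → ¬ M.Anc X Y ∧ ¬ M.Anc Y X := fun h =>
      ⟨fun h' => hM.2 X Y h (hstrict hne h'), fun h' => hM.2 Y X h.symm (hstrict hne.symm h')⟩
    have hdir_not : M.DirEdge Y X → ¬ M.Anc X Y := fun h h' => hM.1 Y (.head' h h')
    refine ⟨⟨fun h => .single h, fun h => ?_⟩, hbi_not, fun h => ?_⟩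
    · rcases htri X Y hXY with h' | h' | h'
      · exact h'
      · exact absurd h (hdir_not h')
      · exact absurd h (hbi_not h').1
    · rcases htri X Y hXY with h' | h' | h'
      · exact absurd (.single h') h.1
      · exact absurd (.single h') h.2
      · exact h'

end MixedGraph

/-- **Lemma MAGDAG2invisibleedge.** If `A → B` and `C → Dn` are invisible
directed edges of the MAG `M` with `A ≠ C` and there is no bi-directed path between `A`
and `C` in `M`, then there is a DAG whose MAG is `M` in which `A, B` share a latent
parent and, simultaneously, `C, Dn` share another latent parent. -/
theorem two_invisible_edges_confounded {V : Type} (M : MixedGraph V) (hM : M.IsMAG)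
    (A B C Dn : V) (hAC : A ≠ C)
    (hAB : M.DirEdge A B) (hABinv : ¬ MagVisible M A B)
    (hCD : M.DirEdge C Dn) (hCDinv : ¬ MagVisible M C Dn)
    (hnobi : ¬ ∃ p : List V, M.IsPathBetween A C p ∧ p.Chain' M.BiEdge) :
    ∃ (L : Type) (G : LatDAG V L), G.IsCausalDAG ∧ IsMAGof M G ∧
      ∃ l₁ l₂ : L, l₁ ≠ l₂ ∧
        G.edge (Sum.inr l₁) (Sum.inl A) ∧ G.edge (Sum.inr l₁) (Sum.inl B) ∧
        G.edge (Sum.inr l₂) (Sum.inl C) ∧ G.edge (Sum.inr l₂) (Sum.inl Dn) := by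
  have hexists : ∀ {a b : V}, M.DirEdge a b → ¬ MagVisible M a b → ∃ (L : Type)
      (D : LatDAG V L), D.IsCausalDAG ∧ IsMAGof M D ∧ ∃ p, D.InducingPath a b p ∧ D.IntoFirst p := by
    intro a b hab hinv
    by_contra hcon
    exact hinv ⟨hab, fun L D hD hMD hp => hcon ⟨L, D, hD, hMD, hp⟩⟩
  obtain ⟨L₁, D₁, hD₁, hM₁, p₁, hp₁, hi₁⟩ := hexists hAB hABinv
  obtain ⟨L₂, D₂, hD₂, hM₂, p₂, hp₂, hi₂⟩ := hexists hCD hCDinv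
  have hirr : ∀ a b, M.Adj a b → a ≠ b := fun _ _ => hM₁.ne_of_adj
  have htri : ∀ a b, M.Adj a b → M.DirEdge a b ∨ M.DirEdge b a ∨ M.BiEdge a b :=
    fun a b h => hM₁.edge_trichotomy h ((hM.1.1 a b).1 h)
  have hAC' : ¬ Relation.ReflTransGen M.BiEdge A C := by
    intro h
    obtain ⟨p, hlen, hnd, hch, hhead, hlast⟩ :=
      exists_nodup_chain (fun _ _ => MixedGraph.BiEdge.symm) h hAC
    exact hnobi ⟨p, ⟨⟨hlen, hnd, hch.imp fun _ _ => MixedGraph.BiEdge.adj⟩, hhead, hlast⟩, hch⟩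
  refine ⟨_, M.confoundedDAG A B C Dn,
    MixedGraph.isCausalDAG_confoundedDAG hM.2.2.1.1 (fun a b h => hirr a b h.adj)
      (hirr A B hAB.adj) (hirr C Dn hCD.adj),
    MixedGraph.isMAGof_confoundedDAG hM.2.2.1 hirr htri hAB hCD
      (hM₁.confoundable hD₁ hAB hp₁ hi₁) (hM₂.confoundable hD₂ hCD hp₂ hi₂) hAC',
    Sum.inr true, Sum.inr false, ?_, Or.inl rfl, Or.inr rfl, Or.inl rfl, Or.inr rfl⟩
  simp

end CG
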